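/- Fix i ∈ {1, …, n}, f_0 ∈ ℝ, and let T = {x ∈ X : f_i(x) ≥ f_0}. Assume 0 < P0(T) < 1. Then, holding the components λ_j for j ≠ i fixed, the map λ_i ↦ Q_λ(T) is strictly increasing on ℝ. In particular, if λ_j = 0 for all j ≠ i, then λ_i > 0 implies Q_λ(T) > P0(T) and λ_i < 0 implies Q_λ(T) < P0(T); hence the agent with Gibbs posterior Q_λ learns the proposition 'f_i(x0) ≥ f_0' relative to the prior P0 whenever λ_i > 0 and the proposition is true, or λ_i < 0 and it is false. -/

import Mathlib

open MeasureTheory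

/-- The partition function `Z_λ = ∫ exp(λ·f(x)) dP0(x)`. -/
noncomputable def gibbsZ {X : Type*} [MeasurableSpace X] (P0 : Measure X)
    {n : ℕ} (f : Fin n → X → ℝ) (lam : Fin n → ℝ) : ℝ :=
  ∫ x, Real.exp (∑ i, lam i * f i x) ∂P0

/-- The Gibbs distribution `Q_λ` with density `exp(λ·f(x))/Z_λ` with respect to `P0`. -/
noncomputable def gibbsMeasure {X : Type*} [MeasurableSpace X] (P0 : Measure X)
    {n : ℕ} (f : Fin n → X → ℝ) (lam : Fin n → ℝ) : Measure X :=
  P0.withDensity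
    (fun x => ENNReal.ofReal (Real.exp (∑ i, lam i * f i x) / gibbsZ P0 f lam))

lemma gibbs_setIntegral_pos {X : Type*} [MeasurableSpace X] (P : Measure X) (S : Set X)
    (hS : MeasurableSet S) (hP : 0 < P S) (h : X → ℝ) (hi : Integrable h P)
    (hpos : ∀ x ∈ S, 0 < h x) : 0 < ∫ x in S, h x ∂P := by
  rw [setIntegral_pos_iff_support_of_nonneg_ae _ hi.integrableOn]
  · refine lt_of_lt_of_le hP (measure_mono fun x hx => ⟨?_, hx⟩)
    exact (hpos x hx).ne'
  · exact (ae_restrict_iff' hS).2 (Filter.Eventually.of_forall fun x hx => (hpos x hx).le)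

lemma gibbs_integrable {X : Type*} [MeasurableSpace X] (P0 : Measure X) [IsProbabilityMeasure P0]
    {n : ℕ} (f : Fin n → X → ℝ) (hmeas : ∀ i, Measurable (f i))
    (hbd : ∃ C : ℝ, ∀ i x, |f i x| ≤ C) (l : Fin n → ℝ) :
    Integrable (fun x => Real.exp (∑ j, l j * f j x)) P0 := by
  obtain ⟨C, hC⟩ := hbd
  refine Integrable.of_bound (C := Real.exp (∑ j, |l j| * C)) ?_ ?_
  · exact (Real.measurable_exp.comp (Finset.measurable_sum _ fun j _ =>
      (hmeas j).const_mul (l j))).aestronglyMeasurable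
  · refine Filter.Eventually.of_forall fun x => ?_
    rw [Real.norm_eq_abs, Real.abs_exp, Real.exp_le_exp]
    refine Finset.sum_le_sum fun j _ => ?_
    calc l j * f j x ≤ |l j * f j x| := le_abs_self _
      _ = |l j| * |f j x| := abs_mul _ _
      _ ≤ |l j| * C := mul_le_mul_of_nonneg_left (hC j x) (abs_nonneg _)

lemma gibbs_apply {X : Type*} [MeasurableSpace X] (P0 : Measure X) [IsProbabilityMeasure P0]
    {n : ℕ} (f : Fin n → X → ℝ) (hmeas : ∀ i, Measurable (f i))
    (hbd : ∃ C : ℝ, ∀ i x, |f i x| ≤ C) (l : Fin n → ℝ) (T : Set X) (hT : MeasurableSet T) :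
    gibbsMeasure P0 f l T = ENNReal.ofReal ((∫ x in T, Real.exp (∑ j, l j * f j x) ∂P0) /
      ((∫ x in T, Real.exp (∑ j, l j * f j x) ∂P0) +
        ∫ x in Tᶜ, Real.exp (∑ j, l j * f j x) ∂P0)) := by
  have hi := gibbs_integrable P0 f hmeas hbd l
  rw [integral_add_compl hT hi, gibbsMeasure, withDensity_apply _ hT, ← integral_div,
    ofReal_integral_eq_lintegral_ofReal (hi.integrableOn.div_const _)]
  · rfl
  · exact Filter.Eventually.of_forall fun x =>
      div_nonneg (Real.exp_pos _).le (integral_nonneg fun x => (Real.exp_pos _).le)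

/-- for `T = {x : f_i(x) ≥ f_0}` with `0 < P0 T < 1`, the map
`λ_i ↦ Q_λ(T)` (with the other components fixed) is strictly increasing; in particular,
if `λ_j = 0` for all `j ≠ i`, then `λ_i > 0` implies `Q_λ(T) > P0(T)` and `λ_i < 0`
implies `Q_λ(T) < P0(T)`, so the agent with posterior `Q_λ` learns the proposition
`f_i(x0) ≥ f_0` whenever `λ_i > 0` and it is true, or `λ_i < 0` and it is false. -/
theorem gibbs_threshold_strictMono
    {X : Type*} [MeasurableSpace X] (P0 : Measure X) [IsProbabilityMeasure P0]
    {n : ℕ} (f : Fin n → X → ℝ)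
    (hmeas : ∀ i, Measurable (f i))
    (hbd : ∃ C : ℝ, ∀ i x, |f i x| ≤ C)
    (i : Fin n) (f0 : ℝ)
    (T : Set X) (hTdef : T = {x : X | f0 ≤ f i x})
    (hT0 : 0 < P0 T) (hT1 : P0 T < 1)
    (lam : Fin n → ℝ) :
    StrictMono (fun t : ℝ => (gibbsMeasure P0 f (Function.update lam i t)) T) ∧
      ((∀ j, j ≠ i → lam j = 0) →
        (0 < lam i → P0 T < (gibbsMeasure P0 f lam) T) ∧
        (lam i < 0 → (gibbsMeasure P0 f lam) T < P0 T)) := by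
  have hT : MeasurableSet T := by
    rw [hTdef]; exact measurableSet_le measurable_const (hmeas i)
  have hTc : 0 < P0 Tᶜ := by
    rw [prob_compl_eq_one_sub hT]; exact tsub_pos_of_lt hT1
  have hmono : StrictMono
      (fun t : ℝ => (gibbsMeasure P0 f (Function.update lam i t)) T) := by
    intro s t hst
    simp only [gibbs_apply P0 f hmeas hbd _ T hT]
    have his := gibbs_integrable P0 f hmeas hbd (Function.update lam i s)
    have hit := gibbs_integrable P0 f hmeas hbd (Function.update lam i t)
    have hrel : ∀ x, Real.exp (∑ j, Function.update lam i t j * f j x) =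
        Real.exp ((t - s) * f i x) * Real.exp (∑ j, Function.update lam i s j * f j x) := by
      intro x
      rw [← Real.exp_add]
      congr 1
      rw [← sub_eq_iff_eq_add, ← Finset.sum_sub_distrib, Finset.sum_eq_single i]
      · simp only [Function.update_self]; ring
      · intro j _ hj
        simp [Function.update_of_ne hj]
      · intro h; exact absurd (Finset.mem_univ i) h
    generalize hgs : (fun x => Real.exp (∑ j, Function.update lam i s j * f j x)) = gs at *
    generalize hgt : (fun x => Real.exp (∑ j, Function.update lam i t j * f j x)) = gt at *
    have hgs' : ∀ x, Real.exp (∑ j, Function.update lam i s j * f j x) = gs x :=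
      fun x => congrFun hgs x
    have hgt' : ∀ x, Real.exp (∑ j, Function.update lam i t j * f j x) = gt x :=
      fun x => congrFun hgt x
    simp only [hgs', hgt'] at hrel ⊢
    have ps : ∀ x, 0 < gs x := fun x => by rw [← hgs']; exact Real.exp_pos _
    have pt : ∀ x, 0 < gt x := fun x => by rw [← hgt']; exact Real.exp_pos _
    have As := gibbs_setIntegral_pos P0 T hT hT0 gs his fun x _ => ps x
    have At := gibbs_setIntegral_pos P0 T hT hT0 gt hit fun x _ => pt x
    have Bs := gibbs_setIntegral_pos P0 Tᶜ hT.compl hTc gs his fun x _ => ps x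
    have Bt := gibbs_setIntegral_pos P0 Tᶜ hT.compl hTc gt hit fun x _ => pt x
    have hA : Real.exp ((t - s) * f0) * ∫ x in T, gs x ∂P0 ≤ ∫ x in T, gt x ∂P0 := by
      rw [← integral_const_mul]
      refine setIntegral_mono_on (his.const_mul _).integrableOn hit.integrableOn hT ?_
      intro x hx
      rw [hrel x]
      refine mul_le_mul_of_nonneg_right (Real.exp_le_exp.2 ?_) (ps x).le
      rw [hTdef] at hx
      exact mul_le_mul_of_nonneg_left hx (sub_pos.2 hst).le
    have hB : ∫ x in Tᶜ, gt x ∂P0 < Real.exp ((t - s) * f0) * ∫ x in Tᶜ, gs x ∂P0 := by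
      have := gibbs_setIntegral_pos P0 Tᶜ hT.compl hTc
        (fun x => Real.exp ((t - s) * f0) * gs x - gt x) ((his.const_mul _).sub hit) (by
          intro x hx
          rw [hTdef] at hx
          have hx' : f i x < f0 := not_le.1 hx
          rw [hrel x, sub_pos]
          exact mul_lt_mul_of_pos_right
            (Real.exp_lt_exp.2 (mul_lt_mul_of_pos_left hx' (sub_pos.2 hst))) (ps x))
      rw [integral_sub (his.const_mul _).integrableOn hit.integrableOn,
        integral_const_mul] at this
      linarith
    rw [ENNReal.ofReal_lt_ofReal_iff (by positivity),
      div_lt_div_iff₀ (by positivity) (by positivity)]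
    have h1 := mul_le_mul_of_nonneg_right hA Bs.le
    have h2 := mul_lt_mul_of_pos_left hB As
    nlinarith
  refine ⟨hmono, fun h0 => ?_⟩
  have hz : gibbsMeasure P0 f (Function.update lam i 0) T = P0 T := by
    have : Function.update lam i 0 = fun _ => 0 := by
      funext j
      by_cases hj : j = i
      · subst hj; simp
      · rw [Function.update_of_ne hj, h0 j hj]
    rw [this]
    simp [gibbsMeasure, gibbsZ]
  have hl : Function.update lam i (lam i) = lam := Function.update_eq_self i lam
  constructor
  · intro h
    have := hmono h
    simpa only [hz, hl] using this
  · intro h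
    have := hmono h
    simpa only [hz, hl] using this
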